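/- Let E be a Banach space such that 𝒜(E) has a right approximate identity. Then the following are equivalent: (a) 𝒜(E) is topologically right Noetherian; (b) every closed right ideal of 𝒜(E) is topologically principal; (c) E is separable. -/

import Mathlib

variable {E : Type*} [NormedAddCommGroup E] [NormedSpace ℂ E] [CompleteSpace E]

/-- The algebra `𝒜(E)` of approximable operators: the norm closure of the finite-rank operators
in `B(E)`. -/
def ApproxOps (E : Type*) [NormedAddCommGroup E] [NormedSpace ℂ E] : Set (E →L[ℂ] E) :=
  closure {T : E →L[ℂ] E | FiniteDimensional ℂ (LinearMap.range (T : E →ₗ[ℂ] E))}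

/-- A closed right ideal of the Banach algebra `𝒜(E)`. -/
def IsClosedRightIdealAppr (E : Type*) [NormedAddCommGroup E] [NormedSpace ℂ E]
    (I : Set (E →L[ℂ] E)) : Prop :=
  I ⊆ ApproxOps E ∧ IsClosed I ∧ (0 : E →L[ℂ] E) ∈ I ∧
    (∀ x ∈ I, ∀ y ∈ I, x + y ∈ I) ∧ (∀ (c : ℂ), ∀ x ∈ I, c • x ∈ I) ∧
    ∀ T ∈ I, ∀ S ∈ ApproxOps E, T.comp S ∈ I

/-- `I` is topologically generated (as a right ideal of `𝒜(E)`) by `T₁, …, Tₙ`. -/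
def TopGenRightAppr (E : Type*) [NormedAddCommGroup E] [NormedSpace ℂ E]
    (I : Set (E →L[ℂ] E)) (n : ℕ) (T : Fin n → (E →L[ℂ] E)) : Prop :=
  (∀ i, T i ∈ I) ∧ I = closure {y : E →L[ℂ] E |
    ∃ (a : Fin n → (E →L[ℂ] E)) (s : Fin n → ℂ),
      (∀ i, a i ∈ ApproxOps E) ∧ y = ∑ i, ((T i).comp (a i) + s i • T i)}

section FiniteRank

variable {X : Type*} [NormedAddCommGroup X] [NormedSpace ℂ X]

/-- The finite-rank operators, as a subspace of the bounded operators. -/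
def finiteRankOps (X : Type*) [NormedAddCommGroup X] [NormedSpace ℂ X] :
    Submodule ℂ (X →L[ℂ] X) where
  carrier := {T | FiniteDimensional ℂ (LinearMap.range (T : X →ₗ[ℂ] X))}
  zero_mem' := by
    rw [Set.mem_ofPred_eq, ContinuousLinearMap.toLinearMap_zero, LinearMap.range_zero]
    infer_instance
  add_mem' {S T} hS hT := by
    simp only [Set.mem_ofPred_eq] at hS hT ⊢
    rw [ContinuousLinearMap.toLinearMap_add]
    exact Submodule.finiteDimensional_of_le (LinearMap.range_add_le _ _)
  smul_mem' c T hT := by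
    simp only [Set.mem_ofPred_eq] at hT ⊢
    rw [ContinuousLinearMap.toLinearMap_smul]
    exact Submodule.finiteDimensional_of_le (LinearMap.range_smul_le_range _ _)

theorem smulRight_mem_approxOps (f : StrongDual ℂ X) (x : X) :
    f.smulRight x ∈ ApproxOps X := by
  refine subset_closure ?_
  have h : LinearMap.range (f.smulRight x : X →ₗ[ℂ] X) ≤ Submodule.span ℂ {x} := by
    rintro _ ⟨z, rfl⟩
    exact Submodule.mem_span_singleton.2 ⟨f z, rfl⟩
  exact Submodule.finiteDimensional_of_le h

theorem isSeparable_range_of_mem_approxOps {T : X →L[ℂ] X} (hT : T ∈ ApproxOps X) :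
    TopologicalSpace.IsSeparable (Set.range T) := by
  obtain ⟨G, hG, hlim⟩ := mem_closure_iff_seq_limit.1 hT
  have hsep : TopologicalSpace.IsSeparable (⋃ n, Set.range (G n)) := by
    refine TopologicalSpace.IsSeparable.iUnion fun n => ?_
    have : FiniteDimensional ℂ (LinearMap.range (G n : X →ₗ[ℂ] X)) := hG n
    have : ProperSpace (LinearMap.range (G n : X →ₗ[ℂ] X)) := FiniteDimensional.proper_rclike ℂ _
    exact TopologicalSpace.IsSeparable.of_subtype
      (LinearMap.range (G n : X →ₗ[ℂ] X) : Set X)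
  refine hsep.closure.mono ?_
  rintro _ ⟨x, rfl⟩
  exact mem_closure_of_tendsto (((ContinuousLinearMap.apply ℂ X x).continuous.tendsto T).comp hlim)
    (Filter.Eventually.of_forall fun n => Set.mem_iUnion.2 ⟨n, x, rfl⟩)

/-- The vectors `y` such that a subspace of operators contains all the operators
`x ↦ f x • y`. -/
def rankOneTargets (I : Submodule ℂ (X →L[ℂ] X)) : Submodule ℂ X where
  carrier := {y | ∀ f : StrongDual ℂ X, f.smulRight y ∈ I}
  zero_mem' f := by simp
  add_mem' {y z} hy hz f := by
    have : f.smulRight (y + z) = f.smulRight y + f.smulRight z := by ext; simp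
    exact this ▸ I.add_mem (hy f) (hz f)
  smul_mem' c y hy f := by
    have : f.smulRight (c • y) = c • f.smulRight y := by
      ext x
      exact smul_comm (f x) c y
    exact this ▸ I.smul_mem c (hy f)

theorem isClosed_rankOneTargets {I : Submodule ℂ (X →L[ℂ] X)}
    (hI : IsClosed (I : Set (X →L[ℂ] X))) : IsClosed (rankOneTargets I : Set X) := by
  have : (rankOneTargets I : Set X) =
      ⋂ f : StrongDual ℂ X, (ContinuousLinearMap.smulRightL ℂ X X f) ⁻¹' (I : Set _) := by
    ext y
    simp [rankOneTargets]
  rw [this]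
  exact isClosed_iInter fun f => hI.preimage (ContinuousLinearMap.continuous _)

theorem mem_of_finiteRank {I : Submodule ℂ (X →L[ℂ] X)} {P : X →L[ℂ] X}
    (hP : FiniteDimensional ℂ (LinearMap.range (P : X →ₗ[ℂ] X)))
    (h : ∀ x, P x ∈ rankOneTargets I) : P ∈ I := by
  let R := LinearMap.range (P : X →ₗ[ℂ] X)
  let b := Module.finBasis ℂ R
  let Q : X →L[ℂ] R := P.codRestrict R fun x => ⟨x, rfl⟩
  have hsum : P = ∑ i, ((LinearMap.toContinuousLinearMap (b.coord i)).comp Q).smulRight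
      (b i : X) := by
    ext x
    have h := congrArg R.subtype (b.sum_repr (Q x))
    rw [map_sum] at h
    rw [sum_apply]
    exact h.symm
  rw [hsum]
  refine I.sum_mem fun i _ => ?_
  obtain ⟨x, hx⟩ := (b i).2
  have hbi : (b i : X) ∈ rankOneTargets I := hx ▸ h x
  exact hbi _

end FiniteRank

section DenseRange

variable {X : Type*} [NormedAddCommGroup X] [NormedSpace ℂ X]

theorem exists_dual_eq_one_of_notMem {p : Submodule ℂ X} [FiniteDimensional ℂ p] {x : X}
    (hx : x ∉ p) : ∃ f : StrongDual ℂ X, f x = 1 ∧ ∀ y ∈ p, f y = 0 := by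
  have : IsClosed (p : Set X) := p.closed_of_finiteDimensional
  obtain ⟨g, hg⟩ := SeparatingDual.exists_eq_one (R := ℂ) (x := p.mkQ x)
    (by simpa using hx)
  refine ⟨g.comp p.mkQL, hg, fun y hy => ?_⟩
  have : p.mkQL y = 0 := by simpa using hy
  simp [this]

/-- In an infinite-dimensional space there is a triangular system of vectors and functionals. -/
theorem exists_triangular_system (h : ¬ FiniteDimensional ℂ X) :
    ∃ (x : ℕ → X) (f : ℕ → StrongDual ℂ X),
      (∀ n, f n (x n) = 1) ∧ ∀ m n, m < n → f n (x m) = 0 := by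
  let b := Module.Basis.ofVectorSpace ℂ X
  have hinf : Infinite (Module.Basis.ofVectorSpaceIndex ℂ X) := by
    by_contra hfin
    have := not_infinite_iff_finite.1 hfin
    exact h (Module.Finite.of_basis b)
  let φ := Infinite.natEmbedding (Module.Basis.ofVectorSpaceIndex ℂ X)
  have hli : LinearIndependent ℂ (b ∘ φ) := b.linearIndependent.comp φ φ.injective
  have key : ∀ n, ∃ f : StrongDual ℂ X, f (b (φ n)) = 1 ∧
      ∀ y ∈ Submodule.span ℂ ((b ∘ φ) '' Set.Iio n), f y = 0 := fun n => by
    have : FiniteDimensional ℂ (Submodule.span ℂ ((b ∘ φ) '' Set.Iio n)) :=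
      FiniteDimensional.span_of_finite ℂ ((Set.finite_Iio n).image _)
    exact exists_dual_eq_one_of_notMem (hli.notMem_span_image (by simp))
  choose f hf hf' using key
  exact ⟨b ∘ φ, f, hf, fun m n hmn => hf' n _ (Submodule.subset_span ⟨m, hmn, rfl⟩)⟩

theorem exists_mem_range_eq_of_finiteDimensional [FiniteDimensional ℂ X]
    (I : Submodule ℂ (X →L[ℂ] X)) :
    ∃ T ∈ I, (rankOneTargets I : Set X) ⊆ closure (Set.range T) := by
  obtain ⟨g, hg⟩ := Submodule.ClosedComplemented.of_finiteDimensional (𝕜 := ℂ) (rankOneTargets I)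
  refine ⟨(rankOneTargets I).subtypeL.comp g, mem_of_finiteRank inferInstance fun x => (g x).2,
    fun y hy => subset_closure ⟨y, ?_⟩⟩
  simpa using congrArg Subtype.val (hg ⟨y, hy⟩)

variable [CompleteSpace X]

theorem exists_mem_dense_range_of_infiniteDimensional [TopologicalSpace.SeparableSpace X]
    (hX : ¬ FiniteDimensional ℂ X) {I : Submodule ℂ (X →L[ℂ] X)}
    (hI : IsClosed (I : Set (X →L[ℂ] X))) :
    ∃ T ∈ I, (rankOneTargets I : Set X) ⊆ closure (Set.range T) := by
  obtain ⟨x, f, hx, hf⟩ := exists_triangular_system hX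
  have hsep : TopologicalSpace.SeparableSpace (rankOneTargets I) :=
    (TopologicalSpace.IsSeparable.of_separableSpace (rankOneTargets I : Set X)).separableSpace
  obtain ⟨y, hdense⟩ := TopologicalSpace.exists_dense_seq (rankOneTargets I)
  let A : ℕ → X →L[ℂ] X := fun n => (f n).smulRight (y n : X)
  obtain ⟨c, hc, hbound⟩ : ∃ c : ℕ → ℝ, (∀ n, 0 < c n) ∧
      ∀ n, ‖(c n : ℂ) • A n‖ ≤ (1 / 2 : ℝ) ^ n := by
    have hpos : ∀ n, 0 < (1 / 2 : ℝ) ^ n / (1 + ‖A n‖) := fun n => by positivity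
    refine ⟨_, hpos, fun n => ?_⟩
    rw [norm_smul, Complex.norm_real, Real.norm_of_nonneg (hpos n).le, div_mul_eq_mul_div,
      div_le_iff₀ (by positivity)]
    gcongr
    linarith
  have hsum : Summable fun n => (c n : ℂ) • A n :=
    Summable.of_norm_bounded summable_geometric_two hbound
  have hmem : ∀ n, (c n : ℂ) • A n ∈ I := fun n => I.smul_mem _ ((y n).2 (f n))
  obtain ⟨T, hT⟩ := hsum
  have hTI : T ∈ I := hI.mem_of_tendsto hT
    (Filter.Eventually.of_forall fun s => I.sum_mem fun n _ => hmem n)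
  have hTx : ∀ m, T (x m) = ∑ n ∈ Finset.range (m + 1), ((c n : ℂ) * f n (x m)) • (y n : X) := by
    intro m
    have h1 : HasSum (fun n => ((c n : ℂ) • A n) (x m)) (T (x m)) :=
      hT.map (ContinuousLinearMap.apply ℂ X (x m) : (X →L[ℂ] X) →L[ℂ] X)
        (ContinuousLinearMap.continuous _)
    have h2 : ∀ n, ((c n : ℂ) • A n) (x m) = ((c n : ℂ) * f n (x m)) • (y n : X) := fun n =>
      (mul_smul (c n : ℂ) (f n (x m)) (y n : X)).symm
    refine (funext h2 ▸ h1).unique (hasSum_sum_of_ne_finset_zero fun n hn => ?_)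
    rw [hf m n (by simpa [Nat.succ_le_iff] using hn), mul_zero, zero_smul]
  have hy : ∀ m, (y m : X) ∈ LinearMap.range (T : X →ₗ[ℂ] X) := by
    intro m
    induction m using Nat.strong_induction_on with
    | _ m ih =>
      have h := hTx m
      rw [Finset.sum_range_succ, hx, mul_one] at h
      have hm : (c m : ℂ) • (y m : X) ∈ LinearMap.range (T : X →ₗ[ℂ] X) := by
        rw [← sub_eq_of_eq_add' h]
        exact Submodule.sub_mem _ ⟨x m, rfl⟩ (Submodule.sum_mem _ fun n hn =>
          Submodule.smul_mem _ _ (ih n (Finset.mem_range.1 hn)))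
      exact (Submodule.smul_mem_iff _ (by exact_mod_cast (hc m).ne')).1 hm
  refine ⟨T, hTI, fun z hz => ?_⟩
  have hz' : (⟨z, hz⟩ : rankOneTargets I) ∈ closure (Set.range y) :=
    hdense ⟨z, hz⟩
  refine closure_mono ?_ (image_closure_subset_closure_image continuous_subtype_val
    ⟨_, hz', rfl⟩)
  rintro _ ⟨_, ⟨n, rfl⟩, rfl⟩
  exact hy n

theorem exists_mem_dense_range [TopologicalSpace.SeparableSpace X]
    {I : Submodule ℂ (X →L[ℂ] X)} (hI : IsClosed (I : Set (X →L[ℂ] X))) :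
    ∃ T ∈ I, (rankOneTargets I : Set X) ⊆ closure (Set.range T) := by
  by_cases hX : FiniteDimensional ℂ X
  · exact exists_mem_range_eq_of_finiteDimensional I
  · exact exists_mem_dense_range_of_infiniteDimensional hX hI

end DenseRange

section Ideals

variable {X : Type*} [NormedAddCommGroup X] [NormedSpace ℂ X]

theorem isClosedRightIdealAppr_approxOps : IsClosedRightIdealAppr X (ApproxOps X) := by
  refine ⟨subset_rfl, isClosed_closure, (finiteRankOps X).topologicalClosure.zero_mem,
    fun x hx y hy => (finiteRankOps X).topologicalClosure.add_mem hx hy,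
    fun c x hx => (finiteRankOps X).topologicalClosure.smul_mem c hx, fun T hT S _ => ?_⟩
  refine map_mem_closure (f := fun R : X →L[ℂ] X => R.comp S) (by fun_prop) hT fun R hR => ?_
  have : FiniteDimensional ℂ (LinearMap.range (R : X →ₗ[ℂ] X)) := hR
  exact Submodule.finiteDimensional_of_le
    (LinearMap.range_comp_le_range (S : X →ₗ[ℂ] X) (R : X →ₗ[ℂ] X))

theorem separableSpace_of_topGenRightAppr {n : ℕ} {T : Fin n → (X →L[ℂ] X)}
    (h : TopGenRightAppr X (ApproxOps X) n T) : TopologicalSpace.SeparableSpace X := by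
  obtain ⟨hT, hgen⟩ := h
  let M : Submodule ℂ X := (Submodule.span ℂ (⋃ i, Set.range (T i))).topologicalClosure
  have hM : TopologicalSpace.IsSeparable (M : Set X) :=
    ((TopologicalSpace.IsSeparable.iUnion fun i =>
      isSeparable_range_of_mem_approxOps (hT i)).span (R := ℂ)).closure
  have hTM : ∀ i x, T i x ∈ M := fun i x =>
    Submodule.le_topologicalClosure _ (Submodule.subset_span (Set.mem_iUnion.2 ⟨i, x, rfl⟩))
  have hmaps : ∀ S ∈ ApproxOps X, ∀ x, S x ∈ M := by
    intro S hS x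
    rw [hgen] at hS
    have hMc : IsClosed (M : Set X) := Submodule.isClosed_topologicalClosure _
    refine closure_minimal ?_ (hMc.preimage (ContinuousLinearMap.apply ℂ X x).continuous) hS
    rintro _ ⟨a, s, -, rfl⟩
    simp only [Set.mem_preimage, ContinuousLinearMap.apply_apply, sum_apply]
    exact M.sum_mem fun i _ => M.add_mem (hTM i _) (M.smul_mem _ (hTM i _))
  refine TopologicalSpace.isSeparable_univ_iff.1 (hM.mono fun x _ => ?_)
  by_cases hx : x = 0
  · exact hx ▸ M.zero_mem
  · obtain ⟨f, hf⟩ := SeparatingDual.exists_eq_one (R := ℂ) hx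
    simpa [hf] using hmaps _ (smulRight_mem_approxOps f x) x

/-- The right ideal of the algebra of approximable operators generated by one operator. -/
noncomputable def principalRightIdeal (T : X →L[ℂ] X) : Submodule ℂ (X →L[ℂ] X) :=
  (finiteRankOps X).topologicalClosure.map (ContinuousLinearMap.compL ℂ X X X T : _ →ₗ[ℂ] _) ⊔
    Submodule.span ℂ {T}

theorem mem_principalRightIdeal {T S : X →L[ℂ] X} :
    S ∈ principalRightIdeal T ↔ ∃ a ∈ ApproxOps X, ∃ s : ℂ, S = T.comp a + s • T := by
  simp only [principalRightIdeal, Submodule.mem_sup, Submodule.mem_map,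
    Submodule.mem_span_singleton]
  constructor
  · rintro ⟨_, ⟨a, ha, rfl⟩, _, ⟨s, rfl⟩, rfl⟩
    exact ⟨a, ha, s, rfl⟩
  · rintro ⟨a, ha, s, rfl⟩
    exact ⟨_, ⟨a, ha, rfl⟩, _, ⟨s, rfl⟩, rfl⟩

theorem topGenRightAppr_one_iff {I : Set (X →L[ℂ] X)} {T : X →L[ℂ] X} :
    TopGenRightAppr X I 1 (fun _ => T) ↔
      T ∈ I ∧ I = ((principalRightIdeal T).topologicalClosure : Set (X →L[ℂ] X)) := by
  have hset : {y : X →L[ℂ] X | ∃ (a : Fin 1 → (X →L[ℂ] X)) (s : Fin 1 → ℂ),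
      (∀ i, a i ∈ ApproxOps X) ∧ y = ∑ i, (T.comp (a i) + s i • T)} =
      (principalRightIdeal T : Set (X →L[ℂ] X)) := by
    ext S
    rw [SetLike.mem_coe, mem_principalRightIdeal]
    constructor
    · rintro ⟨a, s, ha, rfl⟩
      exact ⟨a 0, ha 0, s 0, by simp⟩
    · rintro ⟨a, ha, s, rfl⟩
      exact ⟨fun _ => a, fun _ => s, fun _ => ha, by simp⟩
  rw [TopGenRightAppr, hset, Submodule.topologicalClosure_coe, forall_const]

theorem exists_topGenRightAppr_one [CompleteSpace X] [TopologicalSpace.SeparableSpace X]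
    (rai : ∀ a ∈ ApproxOps X, a ∈ closure (a.comp '' ApproxOps X))
    {I : Set (X →L[ℂ] X)} (hI : IsClosedRightIdealAppr X I) :
    ∃ T, TopGenRightAppr X I 1 T := by
  obtain ⟨hIA, hIc, hzero, hadd, hsmul, hmul⟩ := hI
  let I' : Submodule ℂ (X →L[ℂ] X) :=
    { carrier := I
      zero_mem' := hzero
      add_mem' := fun {x y} hx hy => hadd x hx y hy
      smul_mem' := hsmul }
  obtain ⟨T, hTI, hdense⟩ := exists_mem_dense_range (I := I') hIc
  refine ⟨fun _ => T, topGenRightAppr_one_iff.2 ⟨hTI, subset_antisymm ?_ ?_⟩⟩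
  · set J := (principalRightIdeal T).topologicalClosure
    have hJc : IsClosed (J : Set (X →L[ℂ] X)) := Submodule.isClosed_topologicalClosure _
    have hrange : Set.range T ⊆ rankOneTargets J := by
      rintro _ ⟨x, rfl⟩ f
      refine Submodule.le_topologicalClosure _ (mem_principalRightIdeal.2
        ⟨f.smulRight x, smulRight_mem_approxOps f x, 0, ?_⟩)
      ext
      simp
    have htargets : rankOneTargets I' ≤ rankOneTargets J := fun y hy =>
      closure_minimal hrange (isClosed_rankOneTargets hJc) (hdense hy)
    intro S hS
    have hSx : ∀ x, S x ∈ rankOneTargets J := fun x => htargets fun f => by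
      have : f.smulRight (S x) = S.comp (f.smulRight x) := by ext; simp
      exact this ▸ hmul S hS _ (smulRight_mem_approxOps f x)
    refine closure_minimal ?_ hJc (rai S (hIA hS))
    rintro _ ⟨a, ha, rfl⟩
    refine closure_minimal (fun G hG => ?_)
      (hJc.preimage (ContinuousLinearMap.compL ℂ X X X S).continuous) ha
    have : FiniteDimensional ℂ (LinearMap.range (G : X →ₗ[ℂ] X)) := hG
    refine mem_of_finiteRank (P := S.comp G) ?_ fun x => hSx _
    rw [ContinuousLinearMap.toLinearMap_comp, LinearMap.range_comp]
    infer_instance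
  · refine closure_minimal (fun S hS => ?_) hIc
    obtain ⟨a, ha, s, rfl⟩ := mem_principalRightIdeal.1 hS
    exact hadd _ (hmul T hTI a ha) _ (hsmul s T hTI)

end Ideals

/-- Let `E` be a Banach space such that `𝒜(E)` has a right approximate
identity. Then the following are equivalent: (a) `𝒜(E)` is topologically right Noetherian;
(b) every closed right ideal of `𝒜(E)` is topologically principal; (c) `E` is separable. -/
theorem approxOps_topRightNoetherian_tfae
    (rai : ∃ (ι : Type) (l : Filter ι) (e : ι → (E →L[ℂ] E)), l.NeBot ∧
      (∀ i, e i ∈ ApproxOps E) ∧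
      ∀ a ∈ ApproxOps E, Filter.Tendsto (fun i => a.comp (e i)) l (nhds a)) :
    ((∀ I, IsClosedRightIdealAppr E I → ∃ n T, TopGenRightAppr E I n T) ↔
        (∀ I, IsClosedRightIdealAppr E I → ∃ T, TopGenRightAppr E I 1 T)) ∧
      ((∀ I, IsClosedRightIdealAppr E I → ∃ T, TopGenRightAppr E I 1 T) ↔
        TopologicalSpace.SeparableSpace E) := by
  obtain ⟨ι, l, e, hl, he, hlim⟩ := rai
  have hsep : (∀ I, IsClosedRightIdealAppr E I → ∃ n T, TopGenRightAppr E I n T) →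
      TopologicalSpace.SeparableSpace E := fun h => by
    obtain ⟨n, T, hT⟩ := h _ isClosedRightIdealAppr_approxOps
    exact separableSpace_of_topGenRightAppr hT
  have hprin : TopologicalSpace.SeparableSpace E →
      ∀ I, IsClosedRightIdealAppr E I → ∃ T, TopGenRightAppr E I 1 T := fun _ I hI =>
    exists_topGenRightAppr_one (fun a ha => mem_closure_of_tendsto (hlim a ha)
      (Filter.Eventually.of_forall fun i => ⟨e i, he i, rfl⟩)) hI
  have hweak : (∀ I, IsClosedRightIdealAppr E I → ∃ T, TopGenRightAppr E I 1 T) →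
      ∀ I, IsClosedRightIdealAppr E I → ∃ n T, TopGenRightAppr E I n T :=
    fun h I hI => ⟨1, h I hI⟩
  exact ⟨⟨fun h => hprin (hsep h), hweak⟩, ⟨fun h => hsep (hweak h), hprin⟩⟩
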